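/- Let n1, n2 ≥ 2 be integers and let x ≠ y be real numbers. Let z1, z2 ∈ ℂ satisfy z1² = x and z2² = y, and assume the pair (z1,z2) is (n1,n2)-independent, so that K(n1,n2,x,y) (over ℂ) has the n1·n2 pairwise distinct simple eigenvalues λ_{uv} = (n1−1−2u)z1 + (n2−1−2v)z2 (0 ≤ u ≤ n1−1, 0 ≤ v ≤ n2−1). Then for every pair (u,v), the first standard basis vector e1 = (1,0,…,0) of ℂ^{n1·n2} does not lie in the sum of the eigenspaces of K(n1,n2,x,y) corresponding to the eigenvalues λ_{u'v'} with (u',v') ≠ (u,v); equivalently, all coordinates of e1 with respect to a basis of eigenvectors of K(n1,n2,x,y) are nonzero. -/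

import Mathlib

open Matrix Kronecker

noncomputable section

/-- The modified Kac matrix `𝒦(n,y)`: its 1-based entry `(i,j)` equals `(n-j)·y` if `j = i-1`,
equals `i` if `j = i+1`, and equals `0` otherwise. -/
def kacM (R : Type*) [CommRing R] (n : ℕ) (y : R) : Matrix (Fin n) (Fin n) R :=
  Matrix.of fun i j =>
    if (i : ℕ) = (j : ℕ) + 1 then ((n - 1 - (j : ℕ) : ℕ) : R) * y
    else if (j : ℕ) = (i : ℕ) + 1 then (((i : ℕ) + 1 : ℕ) : R)
    else 0

/-- The modified Kac matrix of second type `K(n1,n2,x,y)`, indexed by pairs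
`(block index, index inside block)`; the pair `(u,v)` (0-based) corresponds to the
1-based position `u·n2 + v + 1`.  Its `n2×n2` blocks `K_{ij}` (1-based) are
`𝒦(n2,y)` if `i = j`, `(n1-j)·x·I` if `j = i-1`, `i·I` if `j = i+1`, and `0` otherwise. -/
def kac2M (R : Type*) [CommRing R] (n1 n2 : ℕ) (x y : R) :
    Matrix (Fin n1 × Fin n2) (Fin n1 × Fin n2) R :=
  Matrix.of fun p q =>
    if p.1 = q.1 then kacM R n2 y p.2 q.2
    else if (p.1 : ℕ) = (q.1 : ℕ) + 1 then
      (if p.2 = q.2 then ((n1 - 1 - (q.1 : ℕ) : ℕ) : R) * x else 0)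
    else if (q.1 : ℕ) = (p.1 : ℕ) + 1 then
      (if p.2 = q.2 then (((p.1 : ℕ) + 1 : ℕ) : R) else 0)
    else 0

/-- A pair `(z1,z2)` of complex numbers is `(n1,n2)`-independent if, for all
`a1, b1 ∈ 𝒩₁ = {n1-1-2r : 0 ≤ r ≤ n1-1}` and `a2, b2 ∈ 𝒩₂ = {n2-1-2r : 0 ≤ r ≤ n2-1}`,
`(a1-b1)z1 + (a2-b2)z2 = 0` implies `a1 = b1` and `a2 = b2`. -/
def IndepPair (n1 n2 : ℕ) (z1 z2 : ℂ) : Prop :=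
  ∀ a1 b1 a2 b2 : ℤ,
    (∃ r : ℕ, r < n1 ∧ a1 = (n1 : ℤ) - 1 - 2 * r) →
    (∃ r : ℕ, r < n1 ∧ b1 = (n1 : ℤ) - 1 - 2 * r) →
    (∃ r : ℕ, r < n2 ∧ a2 = (n2 : ℤ) - 1 - 2 * r) →
    (∃ r : ℕ, r < n2 ∧ b2 = (n2 : ℤ) - 1 - 2 * r) →
    ((a1 - b1 : ℤ) : ℂ) * z1 + ((a2 - b2 : ℤ) : ℂ) * z2 = 0 →
    a1 = b1 ∧ a2 = b2

open Polynomial in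
lemma kac_poly_deriv (a b : ℕ) :
    (1 - X ^ 2) * derivative ((1 + X) ^ a * (1 - X) ^ b : ℂ[X]) =
      (C ((a : ℂ) - b) - C ((a : ℂ) + b) * X) * ((1 + X) ^ a * (1 - X) ^ b) := by
  have ha : (1 + X) * derivative ((1 + X : ℂ[X]) ^ a) = (a : ℂ[X]) * (1 + X) ^ a := by
    cases a with
    | zero => simp
    | succ a => rw [derivative_pow_succ]; simp; ring
  have hb : (1 - X) * derivative ((1 - X : ℂ[X]) ^ b) = -(b : ℂ[X]) * (1 - X) ^ b := by
    cases b with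
    | zero => simp
    | succ a => rw [derivative_pow_succ]; simp; ring
  rw [derivative_mul]
  simp only [map_sub, map_add, map_natCast]
  linear_combination (1 - X) * (1 - X) ^ b * ha + (1 + X) * (1 + X) ^ a * hb

/-- coefficients of the generating polynomial -/
def kacF (a b : ℕ) (j : ℕ) : ℂ :=
  ((1 + Polynomial.X) ^ a * (1 - Polynomial.X) ^ b : Polynomial ℂ).coeff j

lemma kacF_zero (a b : ℕ) : kacF a b 0 = 1 := by
  simp [kacF, Polynomial.coeff_zero_eq_eval_zero]

open Polynomial in
lemma kacF_rec0 (a b : ℕ) : kacF a b 1 = ((a : ℂ) - b) * kacF a b 0 := by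
  have h := congrArg (fun p => p.coeff 0) (kac_poly_deriv a b)
  simp only [kacF]
  generalize ((1 + X) ^ a * (1 - X) ^ b : ℂ[X]) = f at *
  simp [mul_coeff_zero, coeff_derivative] at h
  simpa using h

open Polynomial in
lemma kacF_rec (a b j : ℕ) : ((j : ℂ) + 2) * kacF a b (j + 2) + ((a : ℂ) + b - j) * kacF a b j
    = ((a : ℂ) - b) * kacF a b (j + 1) := by
  have h := congrArg (fun p => p.coeff (j + 1)) (kac_poly_deriv a b)
  simp only [kacF]
  generalize ((1 + X) ^ a * (1 - X) ^ b : ℂ[X]) = f at *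
  have e1 : (1 - X ^ 2) * derivative f = derivative f - X * (X * derivative f) := by ring
  have e2 : (C ((a : ℂ) - b) - C ((a : ℂ) + b) * X) * f
      = C ((a : ℂ) - b) * f - C ((a : ℂ) + b) * (X * f) := by ring
  rw [e1, e2] at h
  simp only [coeff_sub, coeff_C_mul, coeff_X_mul, coeff_derivative] at h
  cases j with
  | zero =>
    simp only [mul_coeff_zero, coeff_X_zero] at h
    push_cast at h ⊢
    simp only [zero_add] at h ⊢
    linear_combination h
  | succ j =>
    simp only [coeff_X_mul, coeff_derivative] at h
    push_cast at h ⊢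
    linear_combination h

open Polynomial in
lemma kacF_top (a b : ℕ) : kacF a b (a + b + 1) = 0 := by
  apply coeff_eq_zero_of_natDegree_lt
  have : ((1 + X) ^ a * (1 - X) ^ b : ℂ[X]).natDegree ≤ a * 1 + b * 1 := by
    refine natDegree_mul_le_of_le (natDegree_pow_le_of_le _ ?_) (natDegree_pow_le_of_le _ ?_)
    · compute_degree
    · compute_degree
  omega

/-- left eigenvector -/
def kacW (n : ℕ) (z : ℂ) (r : ℕ) (j : ℕ) : ℂ :=
  kacF (n - 1 - r) r j / (((n - 1).choose j : ℂ) * z ^ j)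

lemma kacM_sum (n : ℕ) (y : ℂ) (w : ℕ → ℂ) (j : Fin n) :
    ∑ i : Fin n, w i * kacM ℂ n y i j =
      (if (j : ℕ) + 1 < n then w (j + 1) * (((n - 1 - (j : ℕ) : ℕ) : ℂ) * y) else 0) +
      (if 0 < (j : ℕ) then w (j - 1) * (j : ℕ) else 0) := by
  have : ∀ i : Fin n, w i * kacM ℂ n y i j =
      (if (i : ℕ) = j + 1 then w (j + 1) * (((n - 1 - (j : ℕ) : ℕ) : ℂ) * y) else 0) +
      (if (i : ℕ) = j - 1 then (if 0 < (j : ℕ) then w (j - 1) * (j : ℕ) else 0) else 0) := by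
    intro i
    simp only [kacM, Matrix.of_apply]
    by_cases hi : (i : ℕ) = j + 1
    · rw [if_pos hi, if_pos hi, if_neg (by omega), hi]; simp
    · rw [if_neg hi, if_neg hi]
      by_cases hj : (j : ℕ) = i + 1
      · rw [if_pos hj, if_pos (by omega), if_pos (by omega), hj]; simp
      · rw [if_neg hj]
        by_cases hk : (i : ℕ) = j - 1
        · rw [if_pos hk, if_neg (by omega)]; simp
        · rw [if_neg hk]; simp
  rw [Finset.sum_congr rfl (fun i _ => this i), Finset.sum_add_distrib]
  have hj := j.isLt
  rw [Fin.sum_univ_eq_sum_range (fun i => if i = (j : ℕ) + 1 then w (j + 1) * (((n - 1 - (j : ℕ) : ℕ) : ℂ) * y) else 0) n,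
    Fin.sum_univ_eq_sum_range (fun i => if i = (j : ℕ) - 1 then (if 0 < (j : ℕ) then w (j - 1) * (j : ℕ) else 0) else 0) n,
    Finset.sum_ite_eq', Finset.sum_ite_eq']
  simp only [Finset.mem_range]
  rw [if_pos (show (j : ℕ) - 1 < n by omega)]

lemma kacW_eig (n : ℕ) (z : ℂ) (hz : z ≠ 0) (r : ℕ) (hr : r < n) (j : Fin n) :
    ∑ i : Fin n, kacW n z r i * kacM ℂ n (z ^ 2) i j =
      ((((n : ℤ) - 1 - 2 * r : ℤ) : ℂ) * z) * kacW n z r j := by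
  rw [kacM_sum]
  obtain ⟨j, hj⟩ := j
  obtain ⟨a, rfl⟩ : ∃ a, n = a + r + 1 := ⟨n - 1 - r, by omega⟩
  simp only [kacW]
  have e1 : a + r + 1 - 1 = a + r := by omega
  have e2 : a + r - r = a := by omega
  rw [e1, e2]
  have hc : ∀ k, k ≤ a + r → ((a + r).choose k : ℂ) ≠ 0 := fun k hk => by
    exact_mod_cast (Nat.choose_pos hk).ne'
  have t1 : (if j + 1 < a + r + 1 then kacF a r (j + 1) / (((a + r).choose (j + 1) : ℂ) * z ^ (j + 1)) *
      (((a + r - j : ℕ) : ℂ) * z ^ 2) else 0) =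
      ((j : ℂ) + 1) * kacF a r (j + 1) * z / (((a + r).choose j : ℂ) * z ^ j) := by
    split_ifs with h
    · have c1 := hc j (by omega)
      have c2 := hc (j + 1) (by omega)
      have hch : ((a + r).choose (j + 1) : ℂ) * ((j : ℂ) + 1) = (a + r).choose j * ((a + r - j : ℕ) : ℂ) := by
        exact_mod_cast Nat.choose_succ_right_eq (a + r) j
      field_simp
      linear_combination (-kacF a r (j + 1) * z * z ^ j) * hch
    · have : j = a + r := by omega
      subst this
      rw [kacF_top]; simp
  rw [t1]
  cases j with
  | zero =>
    simp only [lt_irrefl, if_false]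
    have := kacF_rec0 a r
    simp only [zero_add]
    rw [this]
    push_cast
    simp
    ring
  | succ j =>
    have := kacF_rec a r j
    simp only [Nat.succ_pos, if_true, Nat.add_sub_cancel]
    have c1 := hc j (by omega)
    have c2 := hc (j + 1) (by omega)
    have hch : ((a + r).choose (j + 1) : ℂ) * ((j : ℂ) + 1) = (a + r).choose j * ((a : ℂ) + r - j) := by
      have := Nat.choose_succ_right_eq (a + r) j
      have h2 : (((a + r - j : ℕ)) : ℂ) = (a : ℂ) + r - j := by
        rw [Nat.cast_sub (by omega)]; push_cast; ring
      rw [← h2]; exact_mod_cast this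
    have t2 : kacF a r j / (((a + r).choose j : ℂ) * z ^ j) * ((j + 1 : ℕ) : ℂ) =
        ((a : ℂ) + r - j) * kacF a r j * z / (((a + r).choose (j + 1) : ℂ) * z ^ (j + 1)) := by
      push_cast
      field_simp
      linear_combination (kacF a r j * z * z ^ j) * hch
    rw [t2, ← add_div, ← mul_div_assoc]
    congr 1
    push_cast
    linear_combination z * this

lemma kac2M_apply (n1 n2 : ℕ) (x y : ℂ) (p q : Fin n1 × Fin n2) :
    kac2M ℂ n1 n2 x y p q = (if p.1 = q.1 then kacM ℂ n2 y p.2 q.2 else 0) +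
      (if p.2 = q.2 then kacM ℂ n1 x p.1 q.1 else 0) := by
  simp only [kac2M, kacM, Matrix.of_apply]
  by_cases h : p.1 = q.1
  · simp [h]
  · simp only [h, if_false, zero_add]
    split_ifs <;> rfl

lemma kac2_left (n1 n2 : ℕ) (x y μ ν : ℂ) (w1 w2 : ℕ → ℂ)
    (e1 : ∀ j : Fin n1, ∑ i : Fin n1, w1 i * kacM ℂ n1 x i j = μ * w1 j)
    (e2 : ∀ j : Fin n2, ∑ i : Fin n2, w2 i * kacM ℂ n2 y i j = ν * w2 j) :
    (fun p : Fin n1 × Fin n2 => w1 p.1 * w2 p.2) ᵥ* kac2M ℂ n1 n2 x y =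
      (μ + ν) • (fun p : Fin n1 × Fin n2 => w1 p.1 * w2 p.2) := by
  ext q
  simp only [Matrix.vecMul, dotProduct, kac2M_apply, mul_add, Finset.sum_add_distrib,
    Pi.smul_apply, smul_eq_mul]
  have a1 : ∑ p : Fin n1 × Fin n2, w1 p.1 * w2 p.2 * (if p.1 = q.1 then kacM ℂ n2 y p.2 q.2 else 0)
      = w1 q.1 * (ν * w2 q.2) := by
    rw [← e2, Fintype.sum_prod_type]
    simp only [mul_ite, mul_zero]
    rw [Finset.sum_comm]
    simp [Finset.mul_sum, mul_assoc]
  have a2 : ∑ p : Fin n1 × Fin n2, w1 p.1 * w2 p.2 * (if p.2 = q.2 then kacM ℂ n1 x p.1 q.1 else 0)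
      = (μ * w1 q.1) * w2 q.2 := by
    rw [← e1, Fintype.sum_prod_type]
    simp only [mul_ite, mul_zero]
    simp [Finset.sum_mul, mul_right_comm]
  rw [a1, a2]; ring

/-- Under the hypotheses of the Kac-matrix eigenvalue lemma, the first
standard basis vector `e1` of `ℂ^{n1·n2}` does not lie in the sum of the eigenspaces of
`K(n1,n2,x,y)` corresponding to the eigenvalues `λ_{u'v'}` with `(u',v') ≠ (u,v)`, for
any fixed `(u,v)`; equivalently all coordinates of `e1` in a basis of eigenvectors are
nonzero. -/
theorem kac2_e1_coordinates_nonzero (n1 n2 : ℕ) (h1 : 2 ≤ n1) (h2 : 2 ≤ n2)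
    (x y : ℝ) (hxy : x ≠ y) (z1 z2 : ℂ) (hz1 : z1 ^ 2 = (x : ℂ)) (hz2 : z2 ^ 2 = (y : ℂ))
    (hind : IndepPair n1 n2 z1 z2) (p : Fin n1 × Fin n2) :
    Pi.single ((⟨0, by omega⟩ : Fin n1), (⟨0, by omega⟩ : Fin n2)) (1 : ℂ) ∉
      ⨆ (q : Fin n1 × Fin n2) (_ : q ≠ p),
        Module.End.eigenspace (Matrix.toLin' (kac2M ℂ n1 n2 (x : ℂ) (y : ℂ)))
          ((((n1 : ℤ) - 1 - 2 * (q.1 : ℕ) : ℤ) : ℂ) * z1 +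
            (((n2 : ℤ) - 1 - 2 * (q.2 : ℕ) : ℤ) : ℂ) * z2) := by
  have hz1' : z1 ≠ 0 := by
    intro h
    have := (hind (n1 - 1) (n1 - 1 - 2) (n2 - 1) (n2 - 1) ⟨0, by omega, by simp⟩
      ⟨1, by omega, by simp⟩ ⟨0, by omega, by simp⟩ ⟨0, by omega, by simp⟩ (by simp [h])).1
    omega
  have hz2' : z2 ≠ 0 := by
    intro h
    have := (hind (n1 - 1) (n1 - 1) (n2 - 1) (n2 - 1 - 2) ⟨0, by omega, by simp⟩
      ⟨0, by omega, by simp⟩ ⟨0, by omega, by simp⟩ ⟨1, by omega, by simp⟩ (by simp [h])).2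
    omega
  rw [← hz1, ← hz2]
  set w : Fin n1 × Fin n2 → ℂ := fun q => kacW n1 z1 p.1 q.1 * kacW n2 z2 p.2 q.2 with hw
  have hl := kac2_left n1 n2 (z1 ^ 2) (z2 ^ 2) _ _ (kacW n1 z1 p.1) (kacW n2 z2 p.2)
    (kacW_eig n1 z1 hz1' p.1 p.1.isLt) (kacW_eig n2 z2 hz2' p.2 p.2.isLt)
  rw [← hw] at hl
  let φ : (Fin n1 × Fin n2 → ℂ) →ₗ[ℂ] ℂ :=
    { toFun := fun v => w ⬝ᵥ v
      map_add' := fun a b => dotProduct_add w a b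
      map_smul' := fun c a => by simp [dotProduct_smul] }
  have hle : (⨆ (q : Fin n1 × Fin n2) (_ : q ≠ p),
        Module.End.eigenspace (Matrix.toLin' (kac2M ℂ n1 n2 (z1 ^ 2) (z2 ^ 2)))
          ((((n1 : ℤ) - 1 - 2 * (q.1 : ℕ) : ℤ) : ℂ) * z1 +
            (((n2 : ℤ) - 1 - 2 * (q.2 : ℕ) : ℤ) : ℂ) * z2)) ≤ LinearMap.ker φ := by
    refine iSup₂_le fun q hq v hv => ?_
    rw [Module.End.mem_eigenspace_iff, Matrix.toLin'_apply] at hv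
    have h3 := Matrix.dotProduct_mulVec w (kac2M ℂ n1 n2 (z1 ^ 2) (z2 ^ 2)) v
    rw [hl, hv, dotProduct_smul, smul_dotProduct, smul_eq_mul, smul_eq_mul, ← sub_eq_zero,
      ← sub_mul] at h3
    rcases mul_eq_zero.mp h3 with h | h
    · exfalso
      apply hq
      have := hind _ _ _ _ ⟨q.1, q.1.isLt, rfl⟩ ⟨p.1, p.1.isLt, rfl⟩ ⟨q.2, q.2.isLt, rfl⟩
        ⟨p.2, p.2.isLt, rfl⟩ (by push_cast at h ⊢; linear_combination h)
      ext <;> omega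
    · exact h
  intro hmem
  have h0 : w ⬝ᵥ Pi.single ((⟨0, by omega⟩ : Fin n1), (⟨0, by omega⟩ : Fin n2)) (1 : ℂ) = 0 :=
    hle hmem
  rw [dotProduct_single] at h0
  simp [hw, kacW, kacF_zero] at h0
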